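/- Let T_0 = 2π/(2h+1) with h ∈ ℕ odd. Then T_opt(T_0) = 3π; in particular the set { t > 0 : μ((D(T_0,t))ᶜ) = 0 } is nonempty. -/

import Mathlib

open MeasureTheory Set Real Filter Topology

noncomputable section

instance : Fact (0 < 2 * Real.pi) := ⟨by positivity⟩

/-- λ_k: 0 for even k, π for odd k. -/
def lam (k : ℕ) : ℝ := if Even k then 0 else Real.pi

/-- Covered set D(T₀, t) ⊆ ℝ/(2πℤ): the union over k of the projections of the
observation intervals (k·T₀, min((k+1)·T₀, t)) translated by −λ_k. -/
def coveredSet (T0 t : ℝ) : Set (AddCircle (2 * Real.pi)) :=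
  ⋃ k : ℕ, (fun a : ℝ => ((a - lam k : ℝ) : AddCircle (2 * Real.pi))) ''
    Set.Ioo ((k : ℝ) * T0) (min (((k : ℝ) + 1) * T0) t)

/-- Optimal control time T_opt(T₀). -/
def Topt (T0 : ℝ) : ℝ :=
  sInf { t : ℝ | 0 < t ∧ volume (coveredSet T0 t)ᶜ = 0 }

theorem aux_cover (h : ℕ) (hho : Odd h) (u x : ℝ) (hu : 0 < u) (hpi : Real.pi = (2 * h + 1) * u)
    (n : ℕ) (hn : n < 4 * h + 2) (h1 : n * u < x) (h2 : x < (n + 1) * u) :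
    (x : AddCircle (2 * Real.pi)) ∈ coveredSet (2 * u) (3 * Real.pi) := by
  have key : ∀ (k : ℕ) (a : ℝ) (z : ℤ), a - lam k = x + z * (2 * Real.pi) →
      k * (2 * u) < a → a < (k + 1) * (2 * u) → a < 3 * Real.pi →
      (x : AddCircle (2 * Real.pi)) ∈ coveredSet (2 * u) (3 * Real.pi) := by
    intro k a z e p q r
    refine mem_iUnion.2 ⟨k, a, ⟨p, lt_min q r⟩, ?_⟩
    change ((a - lam k : ℝ) : AddCircle (2 * Real.pi)) = x
    rw [e, AddCircle.coe_add]
    have : ((z * (2 * Real.pi) : ℝ) : AddCircle (2 * Real.pi)) = 0 := by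
      rw [AddCircle.coe_eq_zero_iff]
      exact ⟨z, by simp⟩
    rw [this, add_zero]
  have hpp := Real.pi_pos
  have hnu : ((n : ℝ) + 1) * u ≤ (4 * h + 2) * u := by
    apply mul_le_mul_of_nonneg_right _ hu.le
    exact_mod_cast hn
  obtain ⟨g, hg⟩ := hho
  obtain ⟨m, r, hr, hm⟩ : ∃ m r : ℕ, r < 4 ∧ n = 4 * m + r :=
    ⟨n / 4, n % 4, Nat.mod_lt _ (by norm_num), by omega⟩
  have hmr : (n : ℝ) = 4 * m + r := by exact_mod_cast hm
  have hgr : (h : ℝ) = 2 * g + 1 := by exact_mod_cast hg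
  by_cases hr2 : r < 2
  · have e : lam (2 * m) = 0 := by simp [lam]
    have b1 : (r : ℝ) * u ≤ 1 * u :=
      mul_le_mul_of_nonneg_right (by exact_mod_cast (by omega : r ≤ 1)) hu.le
    have b0 : 0 ≤ (r : ℝ) * u := by positivity
    rw [hmr] at h1 h2
    refine key (2 * m) x 0 (by rw [e]; simp) ?_ ?_ ?_
    · push_cast; nlinarith
    · push_cast; nlinarith
    · rw [hmr] at hnu; nlinarith
  have b1 : (r : ℝ) * u ≤ 3 * u :=
    mul_le_mul_of_nonneg_right (by exact_mod_cast (by omega : r ≤ 3)) hu.le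
  have b0 : 2 * u ≤ (r : ℝ) * u :=
    mul_le_mul_of_nonneg_right (by exact_mod_cast (by omega : 2 ≤ r)) hu.le
  by_cases hnh : n ≤ 2 * h
  · have e : lam (2 * h + 2 + 2 * m) = 0 := by
      rw [lam, if_pos]; exact ⟨h + 1 + m, by ring⟩
    have b2 : (n : ℝ) * u ≤ (2 * h) * u :=
      mul_le_mul_of_nonneg_right (by exact_mod_cast hnh) hu.le
    refine key (2 * h + 2 + 2 * m) (x + 2 * Real.pi) 1 (by rw [e]; simp) ?_ ?_ ?_
    · rw [hmr] at h1 h2; push_cast; nlinarith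
    · rw [hmr] at h1 h2; push_cast; nlinarith
    · nlinarith
  by_cases hr3 : r = 3
  · subst hr3
    have e : lam (2 * m + h + 2) = Real.pi := by
      rw [lam, if_neg]; rw [Nat.not_even_iff_odd]; exact ⟨m + g + 1, by omega⟩
    rw [hmr] at h1 h2 hnu
    push_cast at h1 h2 hnu
    refine key (2 * m + h + 2) (x + Real.pi) 0 (by rw [e]; simp) ?_ ?_ ?_
    · push_cast; nlinarith
    · push_cast; nlinarith
    · nlinarith
  · obtain rfl : r = 2 := by omega
    obtain ⟨k, hk⟩ : ∃ k, 2 * m = k + h := ⟨2 * m - h, by omega⟩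
    have hkr : (2 : ℝ) * m = k + h := by exact_mod_cast hk
    have hkr' : (k : ℝ) = 2 * m - h := by linarith
    have e : lam k = Real.pi := by
      rw [lam, if_neg]; rw [Nat.not_even_iff_odd]; exact ⟨m - g - 1, by omega⟩
    rw [hmr] at h1 h2 hnu
    push_cast at h1 h2 hnu
    refine key k (x - Real.pi) (-1) (by rw [e]; push_cast; ring) ?_ ?_ ?_
    · rw [hkr']; nlinarith
    · rw [hkr']; nlinarith
    · nlinarith

theorem aux_notmem (h : ℕ) (hho : Odd h) (u t y : ℝ) (hu : 0 < u)
    (hpi : Real.pi = (2 * h + 1) * u) (h1 : 2 * h * u < y) (h2 : y < Real.pi)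
    (h3 : t - 2 * Real.pi < y) :
    (y : AddCircle (2 * Real.pi)) ∉ coveredSet (2 * u) t := by
  intro hy
  have hpp := Real.pi_pos
  obtain ⟨k, a, ⟨p, q⟩, e⟩ := mem_iUnion.1 hy
  obtain ⟨q, r⟩ := lt_min_iff.1 q
  change ((a - lam k : ℝ) : AddCircle (2 * Real.pi)) = y at e
  rw [← sub_eq_zero, ← AddCircle.coe_sub, AddCircle.coe_eq_zero_iff] at e
  obtain ⟨z, hz⟩ := e
  rw [zsmul_eq_mul] at hz
  have hy0 : 0 < y := lt_of_le_of_lt (by positivity) h1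
  have ha0 : 0 < a := lt_of_le_of_lt (by positivity) p
  have hl0 : 0 ≤ lam k ∧ lam k ≤ Real.pi := by
    unfold lam; split_ifs <;> constructor <;> linarith
  have hz0 : z = 0 := by
    rcases lt_trichotomy z 0 with hz' | hz' | hz'
    · have : (z : ℝ) ≤ -1 := by exact_mod_cast (by omega : z ≤ -1)
      nlinarith
    · exact hz'
    · have : (1 : ℝ) ≤ z := by exact_mod_cast (by omega : 1 ≤ z)
      nlinarith
  subst hz0
  have ha : a = y + lam k := by push_cast at hz; linarith
  by_cases hk : Even k
  · have e : lam k = 0 := by rw [lam, if_pos hk]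
    rw [e, add_zero] at ha
    subst ha
    have c1 : (2 * k : ℝ) < 2 * h + 1 := by
      apply lt_of_mul_lt_mul_right _ hu.le; nlinarith
    have c2 : (2 * h : ℝ) < 2 * k + 2 := by
      apply lt_of_mul_lt_mul_right _ hu.le; nlinarith
    have c1' : 2 * k < 2 * h + 1 := by exact_mod_cast c1
    have c2' : 2 * h < 2 * k + 2 := by exact_mod_cast c2
    obtain rfl : k = h := by omega
    exact Nat.not_even_iff_odd.2 hho hk
  · have e : lam k = Real.pi := by rw [lam, if_neg hk]
    rw [e] at ha
    have c1 : (2 * k : ℝ) < 4 * h + 2 := by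
      apply lt_of_mul_lt_mul_right _ hu.le; nlinarith
    have c2 : (4 * h + 1 : ℝ) < 2 * k + 2 := by
      apply lt_of_mul_lt_mul_right _ hu.le; nlinarith
    have c1' : 2 * k < 4 * h + 2 := by exact_mod_cast c1
    have c2' : 4 * h + 1 < 2 * k + 2 := by exact_mod_cast c2
    exact hk ⟨h, by omega⟩

/-- Lemma 1.7 iv): if T₀ = 2π/(2h+1) with h odd, then the system is observable
and T_opt = 3π. -/
theorem stmt_11 (h : ℕ) (hho : Odd h) (T0 : ℝ)
    (hT0 : T0 = 2 * Real.pi / (2 * h + 1)) :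
    { t : ℝ | 0 < t ∧ volume (coveredSet T0 t)ᶜ = 0 }.Nonempty ∧
      Topt T0 = 3 * Real.pi := by
  have hpp := Real.pi_pos
  obtain ⟨u, hu⟩ : ∃ u, u = T0 / 2 := ⟨_, rfl⟩
  have hT : T0 = 2 * u := by linarith
  have hd : (0 : ℝ) < 2 * h + 1 := by positivity
  have hpi : Real.pi = (2 * h + 1) * u := by
    rw [hu, hT0]; field_simp
  have hu0 : 0 < u := by rw [hu, hT0]; positivity
  clear hT0 hu
  subst hT
  have hleast : IsLeast { t : ℝ | 0 < t ∧ volume (coveredSet (2 * u) t)ᶜ = 0 } (3 * Real.pi) := by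
    constructor
    · refine ⟨by positivity, ?_⟩
      have hc : (range (fun n : ℕ => ((n * u : ℝ) : AddCircle (2 * Real.pi)))).Countable :=
        countable_range _
      have hns : NullSingletonClass (volume : Measure (AddCircle (2 * Real.pi))) := by
        refine ⟨fun x => ?_⟩
        rw [← Metric.closedBall_zero, AddCircle.volume_closedBall]
        simp [hpp.le]
      refine measure_mono_null ?_ (hc.measure_zero volume)
      intro w hw
      by_contra hn
      apply hw
      obtain ⟨x, hx, rfl⟩ : ∃ x ∈ Ico (0 : ℝ) (0 + 2 * Real.pi),
          (x : AddCircle (2 * Real.pi)) = w := by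
        have := AddCircle.coe_image_Ico_eq (2 * Real.pi) 0
        have hw' : w ∈ (univ : Set (AddCircle (2 * Real.pi))) := mem_univ w
        rw [← this] at hw'
        exact hw'
      have f1 : (⌊x / u⌋₊ : ℝ) ≤ x / u := Nat.floor_le (div_nonneg hx.1 hu0.le)
      have f2 : x / u < ⌊x / u⌋₊ + 1 := Nat.lt_floor_add_one _
      rw [le_div_iff₀ hu0] at f1
      rw [div_lt_iff₀ hu0] at f2
      have hx2 := hx.2
      refine aux_cover h hho u x hu0 hpi ⌊x / u⌋₊ ?_ (lt_of_le_of_ne f1 ?_) f2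
      · have : (⌊x / u⌋₊ : ℝ) < 4 * h + 2 := by
          apply lt_of_mul_lt_mul_right _ hu0.le; nlinarith
        exact_mod_cast this
      · intro he
        exact hn ⟨⌊x / u⌋₊, by simp only [he]⟩
    · rintro t ⟨ht, hv⟩
      by_contra hlt
      push Not at hlt
      have hop : IsOpen ((fun y : ℝ => (y : AddCircle (2 * Real.pi))) ''
          Ioo (max (2 * h * u) (t - 2 * Real.pi)) Real.pi) :=
        QuotientAddGroup.isOpenMap_coe _ isOpen_Ioo
      have hne : (Ioo (max (2 * h * u) (t - 2 * Real.pi)) Real.pi).Nonempty :=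
        nonempty_Ioo.2 (max_lt (by nlinarith) (by linarith))
      have hpos := hop.measure_pos volume (hne.image _)
      refine absurd (measure_mono_null ?_ hv) hpos.ne'
      rintro _ ⟨y, ⟨hy1, hy2⟩, rfl⟩
      obtain ⟨hy1, hy3⟩ := max_lt_iff.1 hy1
      exact aux_notmem h hho u t y hu0 hpi hy1 hy2 hy3
  exact ⟨⟨_, hleast.1⟩, hleast.csInf_eq⟩
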